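/- (Subword property for twisted involutions.) Let u,v ∈ I(θ). Then u ≤ v in the Bruhat order if and only if for every reduced S̲-expression s̲₁⋯s̲ₖ for v there exist indices 1 ≤ i₁ < i₂ < ⋯ < i_m ≤ k such that u = e·s̲_{i₁}⋯s̲_{i_m}. -/

import Mathlib

namespace TwistedIdentitiesPaper

open scoped Classical

variable {B : Type*} {W : Type*} [Group W] {M : CoxeterMatrix B}

/-- The Bruhat order on `W`, defined via the subword property: `u ≤ v` iff every
reduced expression for `v` contains a subword representing `u`. -/
def bruhatLE (cs : CoxeterSystem M W) (u v : W) : Prop :=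
  ∀ l : List B, cs.IsReduced l → cs.wordProd l = v →
    ∃ l' : List B, l'.Sublist l ∧ cs.wordProd l' = u

/-- The strict Bruhat order. -/
def bruhatLT (cs : CoxeterSystem M W) (u v : W) : Prop :=
  bruhatLE cs u v ∧ u ≠ v

/-- The action `w ↦ w ⋅ s̲ᵢ`: `w ⋅ s̲ᵢ = w sᵢ` if `θ(sᵢ) w sᵢ = w`, and
`w ⋅ s̲ᵢ = θ(sᵢ) w sᵢ` otherwise. -/
noncomputable def twistAct (cs : CoxeterSystem M W) (θ : W ≃* W) (w : W) (i : B) : W :=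
  if θ (cs.simple i) * w * cs.simple i = w then w * cs.simple i
  else θ (cs.simple i) * w * cs.simple i

/-- `e ⋅ s̲₁ ⋯ s̲ₖ` for a word `s₁ ⋯ sₖ`. -/
noncomputable def twistProd (cs : CoxeterSystem M W) (θ : W ≃* W) (l : List B) : W :=
  l.foldl (twistAct cs θ) 1

/-- The set of twisted involutions `I(θ) = {w : θ(w) = w⁻¹}`. -/
def twistedInvolutions (θ : W ≃* W) : Set W := {w | θ w = w⁻¹}

/-- The set of twisted identities `ι(θ) = {θ(w⁻¹) w : w ∈ W}`. -/
def twistedIdentities (θ : W ≃* W) : Set W := {w | ∃ v : W, w = θ v⁻¹ * v}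

/-- The rank `ρ(w)` of a twisted involution: the least `k` such that
`w = e ⋅ s̲₁ ⋯ s̲ₖ`. -/
noncomputable def twistRank (cs : CoxeterSystem M W) (θ : W ≃* W) (w : W) : ℕ :=
  sInf {k | ∃ l : List B, l.length = k ∧ twistProd cs θ l = w}

/-- `θ` has the no-odd-flip (NOF) property: for every `s ∈ S` with `θ(s) ≠ s`,
the order of `s θ(s)` is even or infinite. -/
def NOF (cs : CoxeterSystem M W) (θ : W ≃* W) : Prop :=
  ∀ i : B, θ (cs.simple i) ≠ cs.simple i →
    Even (orderOf (cs.simple i * θ (cs.simple i))) ∨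
      orderOf (cs.simple i * θ (cs.simple i)) = 0

/-! ### The reflection cocycle -/

section Cocycle

variable (cs : CoxeterSystem M W)

/-- The action of a simple reflection on pairs (group element, sign): conjugate the element and
flip the sign exactly when the element is the simple reflection itself. -/
noncomputable def signedConj (i : B) : Function.End (W × ZMod 2) := fun p ↦
  (cs.simple i * p.1 * cs.simple i, p.2 + if p.1 = cs.simple i then 1 else 0)

lemma signedConj_mul_pow_apply (i j : B) (k : ℕ) (p : W × ZMod 2) :
    ((signedConj cs i * signedConj cs j) ^ k) p =
      ((cs.simple i * cs.simple j) ^ k * p.1 * ((cs.simple i * cs.simple j) ^ k)⁻¹,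
        p.2 + ∑ n ∈ Finset.range (2 * k),
          if p.1 = (cs.simple j * cs.simple i) ^ n * cs.simple j then 1 else 0) := by
  induction k with
  | zero => simp; rfl
  | succ k ih =>
    have hinv : ((cs.simple i * cs.simple j) ^ k)⁻¹ = (cs.simple j * cs.simple i) ^ k := by
      rw [← inv_pow]; simp
    have hcomm : cs.simple j * (cs.simple i * cs.simple j) ^ k =
        (cs.simple j * cs.simple i) ^ k * cs.simple j := by
      have h : SemiconjBy (cs.simple j) (cs.simple i * cs.simple j) (cs.simple j * cs.simple i) := by
        simp [SemiconjBy, mul_assoc]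
      exact h.pow_right k
    have h1 : (cs.simple i * cs.simple j) ^ k * p.1 * ((cs.simple i * cs.simple j) ^ k)⁻¹ =
        cs.simple j ↔ p.1 = (cs.simple j * cs.simple i) ^ (2 * k) * cs.simple j := by
      rw [mul_inv_eq_iff_eq_mul, hcomm, ← eq_inv_mul_iff_mul_eq, hinv, ← mul_assoc, ← pow_add,
        two_mul]
    have h2 : cs.simple j * ((cs.simple i * cs.simple j) ^ k * p.1 *
        ((cs.simple i * cs.simple j) ^ k)⁻¹) * cs.simple j = cs.simple i ↔
        p.1 = (cs.simple j * cs.simple i) ^ (2 * k + 1) * cs.simple j := by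
      have h3 : ∀ y, cs.simple j * y * cs.simple j = cs.simple i ↔
          y = cs.simple j * cs.simple i * cs.simple j := by
        intro y
        constructor
        · intro h
          rw [← h]
          simp [mul_assoc]
        · intro h
          rw [h]
          simp [mul_assoc]
      rw [h3, mul_inv_eq_iff_eq_mul, mul_assoc _ (cs.simple j), hcomm, ← eq_inv_mul_iff_mul_eq,
        hinv, ← mul_assoc, ← mul_assoc, ← pow_succ, ← pow_add,
        show k + 1 + k = 2 * k + 1 by ring]
    rw [pow_succ']
    change signedConj cs i (signedConj cs j (((signedConj cs i * signedConj cs j) ^ k) p)) = _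
    rw [ih]
    simp only [signedConj, Nat.mul_succ, Finset.sum_range_succ, Prod.mk.injEq, h1, h2]
    refine ⟨?_, by ring⟩
    rw [pow_succ']
    simp [mul_assoc]

lemma signedConj_isLiftable : M.IsLiftable (signedConj cs) := by
  intro i j
  funext p
  rw [signedConj_mul_pow_apply, cs.simple_mul_simple_pow, two_mul, Finset.sum_range_add]
  have h : ∀ n, (cs.simple j * cs.simple i) ^ (M i j + n) = (cs.simple j * cs.simple i) ^ n := by
    intro n
    rw [pow_add, M.symmetric i j, cs.simple_mul_simple_pow, one_mul]
  simp only [h, CharTwo.add_self_eq_zero]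
  simp
  rfl

/-- The action of `W` on pairs (group element, sign) extending `signedConj`. -/
noncomputable def signedConjHom : W →* Function.End (W × ZMod 2) :=
  cs.lift ⟨signedConj cs, signedConj_isLiftable cs⟩

/-- The sign by which `w` acts on `x`; for a reflection `x` it is `1` exactly when `x` is a right
inversion of `w`. -/
noncomputable def reflectionSign (w x : W) : ZMod 2 := (signedConjHom cs w (x, 0)).2

lemma signedConjHom_simple (i : B) : signedConjHom cs (cs.simple i) = signedConj cs i :=
  cs.lift_apply_simple (signedConj_isLiftable cs) i

lemma signedConjHom_apply (w x : W) (e : ZMod 2) :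
    signedConjHom cs w (x, e) = (w * x * w⁻¹, e + reflectionSign cs w x) := by
  have key : ∃ c : ZMod 2, ∀ e, signedConjHom cs w (x, e) = (w * x * w⁻¹, e + c) := by
    induction w using cs.simple_induction_left with
    | one => exact ⟨0, fun e ↦ by simp [Function.End.one_def]⟩
    | mul_simple_left w i ih =>
      obtain ⟨c, hc⟩ := ih
      refine ⟨c + if w * x * w⁻¹ = cs.simple i then 1 else 0, fun e ↦ ?_⟩
      rw [map_mul, signedConjHom_simple]
      change signedConj cs i (signedConjHom cs w (x, e)) = _
      rw [hc]
      simp [signedConj, mul_assoc, add_assoc]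
  obtain ⟨c, hc⟩ := key
  simp [reflectionSign, hc]

lemma reflectionSign_simple (i : B) (x : W) :
    reflectionSign cs (cs.simple i) x = if x = cs.simple i then 1 else 0 := by
  simp [reflectionSign, signedConjHom_simple, signedConj]

lemma reflectionSign_mul (a b x : W) :
    reflectionSign cs (a * b) x = reflectionSign cs b x + reflectionSign cs a (b * x * b⁻¹) := by
  have h : signedConjHom cs (a * b) (x, 0) = signedConjHom cs a (signedConjHom cs b (x, 0)) := by
    rw [map_mul]; rfl
  simpa [signedConjHom_apply] using congrArg Prod.snd h

lemma reflectionSign_one (x : W) : reflectionSign cs 1 x = 0 := by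
  simpa using reflectionSign_mul cs 1 1 x

lemma reflectionSign_self {t : W} (ht : cs.IsReflection t) : reflectionSign cs t t = 1 := by
  obtain ⟨a, i, rfl⟩ := ht
  have h := reflectionSign_mul cs a a⁻¹ (a * cs.simple i * a⁻¹)
  rw [mul_inv_cancel, reflectionSign_one] at h
  rw [reflectionSign_mul, reflectionSign_mul, reflectionSign_simple]
  simp only [inv_inv, mul_assoc, inv_mul_cancel_left, inv_mul_cancel, mul_one,
    CoxeterSystem.inv_simple, CoxeterSystem.simple_mul_simple_cancel_left, if_true] at h ⊢
  linear_combination -h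

lemma mem_rightInvSeq_of_reflectionSign_ne_zero (l : List B) {t : W}
    (h : reflectionSign cs (cs.wordProd l) t ≠ 0) : t ∈ cs.rightInvSeq l := by
  induction l with
  | nil => simp [reflectionSign_one] at h
  | cons i l ih =>
    rw [cs.wordProd_cons, reflectionSign_mul, reflectionSign_simple] at h
    rw [CoxeterSystem.rightInvSeq, List.mem_cons]
    by_cases h' : cs.wordProd l * t * (cs.wordProd l)⁻¹ = cs.simple i
    · left
      rw [← h']
      group
    · right
      exact ih (by simpa [h'] using h)

lemma length_mul_lt_of_reflectionSign_ne_zero {w t : W} (h : reflectionSign cs w t ≠ 0) :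
    cs.length (w * t) < cs.length w := by
  obtain ⟨l, hl, rfl⟩ := cs.exists_isReduced w
  exact (cs.isRightInversion_of_mem_rightInvSeq hl
    (mem_rightInvSeq_of_reflectionSign_ne_zero cs l h)).2

lemma reflectionSign_ne_zero_iff {w t : W} (ht : cs.IsReflection t) :
    reflectionSign cs w t ≠ 0 ↔ cs.length (w * t) < cs.length w := by
  refine ⟨length_mul_lt_of_reflectionSign_ne_zero cs, fun h h0 ↦ ?_⟩
  have h1 : reflectionSign cs (w * t) t ≠ 0 := by
    rw [reflectionSign_mul, reflectionSign_self cs ht]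
    simp [h0]
  have h2 := length_mul_lt_of_reflectionSign_ne_zero cs h1
  rw [mul_assoc, ht.mul_self, mul_one] at h2
  omega

end Cocycle

/-! ### The Bruhat order generated by reflections -/

section Bruhat

/-- `u` lies directly below `v` along an edge of the Bruhat graph. -/
def BruhatStep (cs : CoxeterSystem M W) (u v : W) : Prop :=
  cs.IsReflection (u⁻¹ * v) ∧ cs.length u < cs.length v

/-- The reflexive transitive closure of the Bruhat graph. -/
def BruhatRel (cs : CoxeterSystem M W) : W → W → Prop :=
  Relation.ReflTransGen (BruhatStep cs)

variable {cs : CoxeterSystem M W}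

lemma BruhatStep.inv {u v : W} (h : BruhatStep cs u v) : BruhatStep cs u⁻¹ v⁻¹ := by
  refine ⟨?_, by simpa using h.2⟩
  have h1 := (h.1.conj u).inv
  have h2 : u⁻¹⁻¹ * v⁻¹ = (u * (u⁻¹ * v) * u⁻¹)⁻¹ := by group
  rw [h2, h1]
  exact h.1.conj u

lemma bruhatStep_mul_simple {w : W} {i : B} (h : cs.length w < cs.length (w * cs.simple i)) :
    BruhatStep cs w (w * cs.simple i) :=
  ⟨by simpa using cs.isReflection_simple i, h⟩

lemma bruhatStep_of_mul_simple_lt {w : W} {i : B}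
    (h : cs.length (w * cs.simple i) < cs.length w) : BruhatStep cs (w * cs.simple i) w :=
  ⟨by simpa [mul_assoc] using (cs.isReflection_simple i).conj 1, h⟩

/-- Right multiplication by a simple reflection preserves every edge of the Bruhat graph other
than the one it reverses. -/
lemma BruhatStep.mul_simple {u v : W} (h : BruhatStep cs u v) (i : B) :
    u * cs.simple i = v ∨ BruhatStep cs (u * cs.simple i) (v * cs.simple i) := by
  obtain ⟨ht, hlt⟩ := h
  set t := u⁻¹ * v with htdef
  have hv : v = u * t := by simp [htdef]
  by_cases hti : t = cs.simple i
  · left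
    rw [hv, hti]
  right
  have ht' : cs.IsReflection (cs.simple i * t * cs.simple i) := by
    simpa using ht.conj (cs.simple i)
  have heq : v * cs.simple i = u * cs.simple i * (cs.simple i * t * cs.simple i) := by
    simp [hv, mul_assoc]
  refine ⟨by rw [heq, inv_mul_cancel_left]; exact ht', ?_⟩
  have h0 : reflectionSign cs u t = 0 := by
    by_contra h
    have := (reflectionSign_ne_zero_iff cs ht).1 h
    rw [← hv] at this
    omega
  have h1 : reflectionSign cs (u * cs.simple i) (cs.simple i * t * cs.simple i) = 0 := by
    have hne : cs.simple i * t * cs.simple i ≠ cs.simple i := by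
      intro h
      apply hti
      have := congrArg (fun x ↦ cs.simple i * x * cs.simple i) h
      simpa [mul_assoc] using this
    rw [reflectionSign_mul, reflectionSign_simple, if_neg hne]
    simpa [mul_assoc] using h0
  have h2 := mt (reflectionSign_ne_zero_iff cs ht').2 (not_not.2 h1)
  rw [← heq] at h2
  have h3 := ht'.length_mul_left_ne (u * cs.simple i)
  rw [← heq] at h3
  omega

namespace BruhatRel

lemma refl (w : W) : BruhatRel cs w w := Relation.ReflTransGen.refl

lemma trans {u v w : W} (h : BruhatRel cs u v) (h' : BruhatRel cs v w) : BruhatRel cs u w :=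
  Relation.ReflTransGen.trans h h'

lemma inv {u v : W} (h : BruhatRel cs u v) : BruhatRel cs u⁻¹ v⁻¹ := by
  induction h with
  | refl => exact refl _
  | tail _ h ih => exact Relation.ReflTransGen.tail ih h.inv

lemma length_le {u v : W} (h : BruhatRel cs u v) : cs.length u ≤ cs.length v := by
  induction h with
  | refl => rfl
  | tail _ h ih => exact ih.trans h.2.le

lemma eq_one {u : W} (h : BruhatRel cs u 1) : u = 1 := by
  simpa using h.length_le

lemma mul_simple {u v : W} (h : BruhatRel cs u v) (i : B) :
    BruhatRel cs (u * cs.simple i) (v * cs.simple i) ∨ BruhatRel cs (u * cs.simple i) v := by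
  induction h using Relation.ReflTransGen.head_induction_on with
  | refl => exact Or.inl (refl _)
  | head h h' ih =>
    rcases h.mul_simple i with he | hs
    · exact Or.inr (he ▸ h')
    · exact ih.imp (Relation.ReflTransGen.head hs) (Relation.ReflTransGen.head hs)

lemma of_mul_simple {u v : W} (h : BruhatRel cs u v) (i : B) :
    BruhatRel cs u (v * cs.simple i) ∨
      BruhatRel cs (u * cs.simple i) (v * cs.simple i) := by
  induction h using Relation.ReflTransGen.head_induction_on with
  | refl => exact Or.inr (refl _)
  | head h h' ih =>
    rcases ih with ih | ih
    · exact Or.inl (Relation.ReflTransGen.head h ih)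
    · rcases h.mul_simple i with he | hs
      · left
        rw [← he] at ih
        simpa using ih
      · exact Or.inr (Relation.ReflTransGen.head hs ih)

lemma mul_simple_of_lt {u v : W} (h : BruhatRel cs u v) {i : B}
    (hv : cs.length v < cs.length (v * cs.simple i)) :
    BruhatRel cs (u * cs.simple i) (v * cs.simple i) :=
  (h.mul_simple i).elim id fun h' ↦ h'.tail (bruhatStep_mul_simple hv)

lemma mul_simple_le {u v : W} (h : BruhatRel cs u v) {i : B}
    (hv : cs.length (v * cs.simple i) < cs.length v) : BruhatRel cs (u * cs.simple i) v :=
  (h.mul_simple i).elim (fun h' ↦ h'.tail (bruhatStep_of_mul_simple_lt hv)) id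

/-- The lifting property for a common descent. -/
lemma lift_of_lt {u v : W} (h : BruhatRel cs u v) {i : B}
    (hu : cs.length (u * cs.simple i) < cs.length u) :
    BruhatRel cs (u * cs.simple i) (v * cs.simple i) :=
  (h.of_mul_simple i).elim (Relation.ReflTransGen.head (bruhatStep_of_mul_simple_lt hu)) id

/-- The lifting property for an ascent of the smaller element. -/
lemma lift_of_gt {u v : W} (h : BruhatRel cs u v) {i : B}
    (hu : cs.length u < cs.length (u * cs.simple i)) :
    BruhatRel cs u (v * cs.simple i) :=
  (h.of_mul_simple i).elim id (Relation.ReflTransGen.head (bruhatStep_mul_simple hu))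

lemma simple_mul_le {u v : W} (h : BruhatRel cs u v) {i : B}
    (hv : cs.length (cs.simple i * v) < cs.length v) : BruhatRel cs (cs.simple i * u) v := by
  have hv' : cs.length (v⁻¹ * cs.simple i) < cs.length v⁻¹ := by
    rw [← cs.length_inv (v⁻¹ * cs.simple i)]
    simpa using hv
  simpa using (h.inv.mul_simple_le hv').inv

lemma left_lift_of_lt {u v : W} (h : BruhatRel cs u v) {i : B}
    (hu : cs.length (cs.simple i * u) < cs.length u) :
    BruhatRel cs (cs.simple i * u) (cs.simple i * v) := by
  have hu' : cs.length (u⁻¹ * cs.simple i) < cs.length u⁻¹ := by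
    rw [← cs.length_inv (u⁻¹ * cs.simple i)]
    simpa using hu
  simpa using (h.inv.lift_of_lt hu').inv

lemma left_lift_of_gt {u v : W} (h : BruhatRel cs u v) {i : B}
    (hu : cs.length u < cs.length (cs.simple i * u)) :
    BruhatRel cs u (cs.simple i * v) := by
  have hu' : cs.length u⁻¹ < cs.length (u⁻¹ * cs.simple i) := by
    rw [← cs.length_inv (u⁻¹ * cs.simple i)]
    simpa using hu
  simpa using (h.inv.lift_of_gt hu').inv

lemma exists_sublist {u v : W} (h : BruhatRel cs u v) :
    ∀ l : List B, cs.wordProd l = v → ∃ l' : List B, l'.Sublist l ∧ cs.wordProd l' = u := by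
  induction h with
  | refl => exact fun l hl ↦ ⟨l, List.Sublist.refl l, hl⟩
  | @tail w v _ h ih =>
    intro l hl
    have ht : cs.IsReflection (v⁻¹ * w) := by
      have := h.1.inv
      rw [show v⁻¹ * w = (w⁻¹ * v)⁻¹ by group, this]
      exact h.1
    have hmem : v⁻¹ * w ∈ cs.rightInvSeq l := by
      apply mem_rightInvSeq_of_reflectionSign_ne_zero
      rw [hl, reflectionSign_ne_zero_iff cs ht]
      simpa using h.2
    obtain ⟨n, hn, hget⟩ := List.mem_iff_getElem.1 hmem
    have hw := cs.wordProd_mul_getD_rightInvSeq l n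
    rw [List.getD_eq_getElem _ _ hn, hget, hl, mul_inv_cancel_left] at hw
    obtain ⟨l', hl', hu⟩ := ih _ hw.symm
    exact ⟨l', hl'.trans (List.eraseIdx_sublist l n), hu⟩

end BruhatRel

lemma bruhatRel_of_sublist {l : List B} (hl : cs.IsReduced l) {l' : List B} (h : l'.Sublist l) :
    BruhatRel cs (cs.wordProd l') (cs.wordProd l) := by
  induction h with
  | slnil => exact .refl _
  | @cons l₁ l₂ i h ih =>
    have h2 : cs.IsReduced l₂ := by simpa using hl.drop 1
    refine (ih h2).trans ?_
    have := ((BruhatRel.refl (cs := cs) (cs.wordProd (i :: l₂))).simple_mul_le (i := i) ?_)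
    · simpa [cs.wordProd_cons] using this
    · rw [hl.eq, cs.wordProd_cons, cs.simple_mul_simple_cancel_left, h2.eq]
      simp
  | @cons_cons l₁ l₂ i h ih =>
    have h2 : cs.IsReduced l₂ := by simpa using hl.drop 1
    have hlt : cs.length (cs.simple i * cs.wordProd (i :: l₂)) <
        cs.length (cs.wordProd (i :: l₂)) := by
      rw [hl.eq, cs.wordProd_cons, cs.simple_mul_simple_cancel_left, h2.eq]
      simp
    rw [cs.wordProd_cons i l₁]
    refine BruhatRel.simple_mul_le ((ih h2).trans ?_) hlt
    have := ((BruhatRel.refl (cs := cs) (cs.wordProd (i :: l₂))).simple_mul_le hlt)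
    simpa [cs.wordProd_cons] using this

lemma bruhatLE_iff_bruhatRel {u v : W} : bruhatLE cs u v ↔ BruhatRel cs u v := by
  refine ⟨fun h ↦ ?_, fun h l _ hl ↦ h.exists_sublist l hl⟩
  obtain ⟨l, hl, hv⟩ := cs.exists_isReduced v
  obtain ⟨l', hl', rfl⟩ := h l hl hv.symm
  rw [hv]
  exact bruhatRel_of_sublist hl hl'

end Bruhat

/-! ### The twisted action -/

section Twisted

variable {cs : CoxeterSystem M W} {θ : W ≃* W}

lemma length_map_le (hθS : ∀ i : B, ∃ j : B, θ (cs.simple i) = cs.simple j) (w : W) :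
    cs.length (θ w) ≤ cs.length w := by
  choose f hf using hθS
  obtain ⟨l, hl, rfl⟩ := cs.exists_isReduced w
  have h : θ (cs.wordProd l) = cs.wordProd (l.map f) := by
    simp [CoxeterSystem.wordProd, map_list_prod, Function.comp_def, hf]
  rw [h, hl.eq]
  simpa using cs.length_wordProd_le (l.map f)

lemma length_map (hθ : Function.Involutive θ)
    (hθS : ∀ i : B, ∃ j : B, θ (cs.simple i) = cs.simple j) (w : W) :
    cs.length (θ w) = cs.length w := by
  refine le_antisymm (length_map_le hθS w) ?_
  simpa [hθ w] using length_map_le hθS (θ w)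

lemma length_map_simple_mul (hθ : Function.Involutive θ)
    (hθS : ∀ i : B, ∃ j : B, θ (cs.simple i) = cs.simple j) {w : W}
    (hw : w ∈ twistedInvolutions θ) (i : B) :
    cs.length (θ (cs.simple i) * w) = cs.length (w * cs.simple i) := by
  have h : θ (w * cs.simple i) = (θ (cs.simple i) * w)⁻¹ := by
    rw [map_mul, show θ w = w⁻¹ from hw, mul_inv_rev, ← map_inv, cs.inv_simple]
  rw [← cs.length_inv, ← h, length_map hθ hθS]

lemma twistAct_mem (hθ : Function.Involutive θ) {w : W} (hw : w ∈ twistedInvolutions θ) (i : B) :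
    twistAct cs θ w i ∈ twistedInvolutions θ := by
  have hw' : θ w = w⁻¹ := hw
  change θ (twistAct cs θ w i) = (twistAct cs θ w i)⁻¹
  have hs : θ (cs.simple i) * θ (cs.simple i) = 1 := by
    rw [← map_mul, cs.simple_mul_simple_self, map_one]
  have hinv : (θ (cs.simple i))⁻¹ = θ (cs.simple i) := inv_eq_of_mul_eq_one_left hs
  unfold twistAct
  split_ifs with h
  · rw [map_mul, hw', mul_inv_rev, cs.inv_simple]
    conv_lhs => rw [← h]
    simp only [mul_inv_rev, cs.inv_simple, hinv, mul_assoc, hs, mul_one]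
  · simp only [map_mul, hθ (cs.simple i), hw', mul_inv_rev, cs.inv_simple, hinv, mul_assoc]

lemma twistAct_twistAct (w : W) (i : B) : twistAct cs θ (twistAct cs θ w i) i = w := by
  have hs : ∀ x, θ (cs.simple i) * (θ (cs.simple i) * x) = x := by
    intro x
    rw [← mul_assoc, ← map_mul, cs.simple_mul_simple_self, map_one, one_mul]
  by_cases h : θ (cs.simple i) * w * cs.simple i = w
  · have h1 : twistAct cs θ w i = w * cs.simple i := if_pos h
    have h2 : θ (cs.simple i) * (w * cs.simple i) * cs.simple i = w * cs.simple i := by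
      rw [← mul_assoc, h]
    rw [h1, twistAct, if_pos h2, cs.simple_mul_simple_cancel_right]
  · have h1 : twistAct cs θ w i = θ (cs.simple i) * w * cs.simple i := if_neg h
    have h2 : θ (cs.simple i) * (θ (cs.simple i) * w * cs.simple i) * cs.simple i = w := by
      simp [mul_assoc, hs]
    rw [h1, twistAct, h2, if_neg (Ne.symm h)]

lemma twistAct_eq_or (w : W) (i : B) :
    twistAct cs θ w i = w * cs.simple i ∨
      twistAct cs θ w i = θ (cs.simple i) * (w * cs.simple i) := by
  unfold twistAct
  split_ifs
  · exact Or.inl rfl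
  · exact Or.inr (mul_assoc _ _ _)

/-- At an ascent, the twisted action multiplies on the right and then, if this increases the
length, on the left. -/
lemma bruhatRel_twistAct_of_gt (hθ : Function.Involutive θ)
    (hθS : ∀ i : B, ∃ j : B, θ (cs.simple i) = cs.simple j) {w : W}
    (hw : w ∈ twistedInvolutions θ) {i : B} (h : cs.length w < cs.length (w * cs.simple i)) :
    BruhatRel cs (w * cs.simple i) (twistAct cs θ w i) := by
  unfold twistAct
  split_ifs with hc
  · exact .refl _
  obtain ⟨j, hj⟩ := hθS i
  have hl := length_map_simple_mul hθ hθS hw i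
  have hstep : BruhatStep cs w (θ (cs.simple i) * w) := by
    refine ⟨?_, by omega⟩
    rw [hj, ← mul_assoc]
    simpa using (cs.isReflection_simple j).conj w⁻¹
  rcases hstep.mul_simple i with he | hs
  · exact absurd (by rw [← he, cs.simple_mul_simple_cancel_right]) hc
  · exact .single hs

lemma bruhatRel_twistAct_of_lt (hθ : Function.Involutive θ)
    (hθS : ∀ i : B, ∃ j : B, θ (cs.simple i) = cs.simple j) {w : W}
    (hw : w ∈ twistedInvolutions θ) {i : B} (h : cs.length (w * cs.simple i) < cs.length w) :
    BruhatRel cs (twistAct cs θ w i) (w * cs.simple i) := by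
  unfold twistAct
  split_ifs with hc
  · exact .refl _
  obtain ⟨j, hj⟩ := hθS i
  have hl := length_map_simple_mul hθ hθS hw i
  have hstep : BruhatStep cs (θ (cs.simple i) * w) w := by
    refine ⟨?_, by omega⟩
    rw [hj, mul_inv_rev, cs.inv_simple]
    simpa using (cs.isReflection_simple j).conj w⁻¹
  rcases hstep.mul_simple i with he | hs
  · exact absurd he hc
  · exact .single hs

lemma length_twistAct_mul_lt (hθ : Function.Involutive θ)
    (hθS : ∀ i : B, ∃ j : B, θ (cs.simple i) = cs.simple j) {w : W}
    (hw : w ∈ twistedInvolutions θ) {i : B} (h : cs.length w < cs.length (w * cs.simple i)) :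
    cs.length (twistAct cs θ w i * cs.simple i) < cs.length (twistAct cs θ w i) := by
  by_contra hn
  have hn' : cs.length (twistAct cs θ w i) < cs.length (twistAct cs θ w i * cs.simple i) := by
    have := cs.length_mul_simple_ne (twistAct cs θ w i) i
    omega
  have h1 := (bruhatRel_twistAct_of_gt hθ hθS (twistAct_mem hθ hw i) hn').length_le
  rw [twistAct_twistAct] at h1
  have h2 := (bruhatRel_twistAct_of_gt hθ hθS hw h).length_le
  omega

/-- The lifting property for the twisted action at a descent of the smaller element. -/
lemma twistAct_lift_of_lt (hθ : Function.Involutive θ)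
    (hθS : ∀ i : B, ∃ j : B, θ (cs.simple i) = cs.simple j) {u w : W}
    (hu : u ∈ twistedInvolutions θ) {i : B}
    (hd : cs.length (u * cs.simple i) < cs.length u) (h : BruhatRel cs u (twistAct cs θ w i)) :
    BruhatRel cs (twistAct cs θ u i) w := by
  have h1 := h.lift_of_lt hd
  by_cases hc : θ (cs.simple i) * w * cs.simple i = w
  · rw [show twistAct cs θ w i = w * cs.simple i from if_pos hc,
      cs.simple_mul_simple_cancel_right] at h1
    exact (bruhatRel_twistAct_of_lt hθ hθS hu hd).trans h1
  · rw [show twistAct cs θ w i = θ (cs.simple i) * w * cs.simple i from if_neg hc,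
      cs.simple_mul_simple_cancel_right] at h1
    obtain ⟨j, hj⟩ := hθS i
    rw [hj] at h1
    by_cases hcu : θ (cs.simple i) * u * cs.simple i = u
    · rw [show twistAct cs θ u i = u * cs.simple i from if_pos hcu]
      have h2 := h1.left_lift_of_gt (i := j) (by rw [← mul_assoc, ← hj, hcu]; exact hd)
      rwa [cs.simple_mul_simple_cancel_left] at h2
    · have h3 : twistAct cs θ u i = cs.simple j * (u * cs.simple i) := by
        rw [← mul_assoc, ← hj]
        exact if_neg hcu
      have h4 := (bruhatRel_twistAct_of_lt hθ hθS hu hd).length_le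
      rw [h3] at h4 ⊢
      have h5 := h1.left_lift_of_lt (i := j)
        (lt_of_le_of_ne h4 (cs.length_simple_mul_ne (u * cs.simple i) j))
      rwa [cs.simple_mul_simple_cancel_left] at h5

/-- The lifting property for the twisted action at an ascent of the smaller element. -/
lemma twistAct_lift_of_gt (hθ : Function.Involutive θ)
    (hθS : ∀ i : B, ∃ j : B, θ (cs.simple i) = cs.simple j) {u w : W}
    (hu : u ∈ twistedInvolutions θ) {i : B}
    (hd : cs.length u < cs.length (u * cs.simple i)) (h : BruhatRel cs u (twistAct cs θ w i)) :
    BruhatRel cs u w := by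
  have h1 := h.lift_of_gt hd
  by_cases hc : θ (cs.simple i) * w * cs.simple i = w
  · rwa [show twistAct cs θ w i = w * cs.simple i from if_pos hc,
      cs.simple_mul_simple_cancel_right] at h1
  · rw [show twistAct cs θ w i = θ (cs.simple i) * w * cs.simple i from if_neg hc,
      cs.simple_mul_simple_cancel_right] at h1
    have hl := length_map_simple_mul hθ hθS hu i
    obtain ⟨j, hj⟩ := hθS i
    rw [hj] at h1 hl
    have h2 := h1.left_lift_of_gt (i := j) (by omega)
    rwa [cs.simple_mul_simple_cancel_left] at h2

/-- The twisted action at an ascent of the larger element is monotone. -/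
lemma twistAct_mono (hθ : Function.Involutive θ)
    (hθS : ∀ i : B, ∃ j : B, θ (cs.simple i) = cs.simple j) {u w : W}
    (hw : w ∈ twistedInvolutions θ) {i : B}
    (hd : cs.length w < cs.length (w * cs.simple i)) (h : BruhatRel cs u w) :
    BruhatRel cs (twistAct cs θ u i) (twistAct cs θ w i) := by
  have h1 := (h.mul_simple_of_lt hd).trans (bruhatRel_twistAct_of_gt hθ hθS hw hd)
  rcases twistAct_eq_or (cs := cs) (θ := θ) u i with he | he
  · rwa [he]
  · rw [he]
    have hl := length_map_simple_mul hθ hθS (twistAct_mem (cs := cs) hθ hw i) i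
    have hlt := length_twistAct_mul_lt hθ hθS hw hd
    obtain ⟨j, hj⟩ := hθS i
    rw [hj] at hl ⊢
    exact h1.simple_mul_le (by omega)

lemma twistProd_concat (l : List B) (i : B) :
    twistProd cs θ (l ++ [i]) = twistAct cs θ (twistProd cs θ l) i := by
  simp [twistProd]

lemma twistProd_mem (hθ : Function.Involutive θ) (l : List B) :
    twistProd cs θ l ∈ twistedInvolutions θ := by
  induction l using List.reverseRecOn with
  | nil => simp [twistProd, twistedInvolutions]
  | append_singleton l i ih =>
    rw [twistProd_concat]
    exact twistAct_mem hθ ih i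

lemma exists_twistProd_eq (hθ : Function.Involutive θ)
    (hθS : ∀ i : B, ∃ j : B, θ (cs.simple i) = cs.simple j) {w : W}
    (hw : w ∈ twistedInvolutions θ) : ∃ l : List B, twistProd cs θ l = w := by
  induction hn : cs.length w using Nat.strong_induction_on generalizing w with
  | _ n ih =>
    by_cases h1 : w = 1
    · exact ⟨[], h1.symm⟩
    obtain ⟨i, hi⟩ := cs.exists_rightDescent_of_ne_one h1
    have h2 := (bruhatRel_twistAct_of_lt hθ hθS hw hi).length_le
    obtain ⟨l, hl⟩ := ih _ (hn ▸ h2.trans_lt hi) (twistAct_mem hθ hw i) rfl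
    exact ⟨l ++ [i], by rw [twistProd_concat, hl, twistAct_twistAct]⟩

/-- A word along which every step of the twisted action is at an ascent. -/
def IsAscending (cs : CoxeterSystem M W) (θ : W ≃* W) (l : List B) : Prop :=
  ∀ (a : List B) (i : B), a ++ [i] <+: l →
    cs.length (twistProd cs θ a) < cs.length (twistProd cs θ a * cs.simple i)

lemma isAscending_concat_iff {l : List B} {i : B} :
    IsAscending cs θ (l ++ [i]) ↔ IsAscending cs θ l ∧
      cs.length (twistProd cs θ l) < cs.length (twistProd cs θ l * cs.simple i) := by
  refine ⟨fun h ↦ ⟨fun a j ha ↦ h a j (ha.trans (List.prefix_append l [i])),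
    h l i (List.prefix_refl _)⟩, fun h a j ha ↦ ?_⟩
  rcases List.prefix_concat_iff.1 ha with he | hp
  · obtain ⟨rfl, he⟩ := List.append_inj' he rfl
    obtain rfl : j = i := by simpa using he
    exact h.2
  · exact h.1 a j hp

lemma IsAscending.exists_sublist (hθ : Function.Involutive θ)
    (hθS : ∀ i : B, ∃ j : B, θ (cs.simple i) = cs.simple j) {l : List B}
    (hl : IsAscending cs θ l) {u : W} (hu : u ∈ twistedInvolutions θ)
    (h : BruhatRel cs u (twistProd cs θ l)) :
    ∃ l' : List B, l'.Sublist l ∧ twistProd cs θ l' = u := by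
  induction l using List.reverseRecOn generalizing u with
  | nil => exact ⟨[], List.Sublist.refl _, h.eq_one.symm⟩
  | append_singleton l i ih =>
    rw [twistProd_concat] at h
    have hl' := (isAscending_concat_iff.1 hl).1
    rcases lt_or_gt_of_ne (cs.length_mul_simple_ne u i) with hd | hd
    · obtain ⟨l', hs, he⟩ := ih hl' (twistAct_mem hθ hu i) (twistAct_lift_of_lt hθ hθS hu hd h)
      exact ⟨l' ++ [i], hs.append (List.Sublist.refl _),
        by rw [twistProd_concat, he, twistAct_twistAct]⟩
    · obtain ⟨l', hs, he⟩ := ih hl' hu (twistAct_lift_of_gt hθ hθS hu hd h)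
      exact ⟨l', hs.trans (List.sublist_append_left l [i]), he⟩

lemma IsAscending.bruhatRel_of_sublist (hθ : Function.Involutive θ)
    (hθS : ∀ i : B, ∃ j : B, θ (cs.simple i) = cs.simple j) {l : List B}
    (hl : IsAscending cs θ l) {l' : List B} (h : l'.Sublist l) :
    BruhatRel cs (twistProd cs θ l') (twistProd cs θ l) := by
  induction l using List.reverseRecOn generalizing l' with
  | nil =>
    rw [List.sublist_nil.1 h]
    exact .refl _
  | append_singleton l i ih =>
    obtain ⟨hl, hd⟩ := isAscending_concat_iff.1 hl
    have hm := twistProd_mem (cs := cs) hθ l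
    obtain ⟨a, b, rfl, ha, hb⟩ := List.sublist_append_iff.1 h
    rw [twistProd_concat]
    rcases List.sublist_singleton.1 hb with rfl | rfl
    · rw [List.append_nil]
      exact (Relation.ReflTransGen.tail (ih hl ha) (bruhatStep_mul_simple hd)).trans
        (bruhatRel_twistAct_of_gt hθ hθS hm hd)
    · rw [twistProd_concat]
      exact twistAct_mono hθ hθS hm hd (ih hl ha)

lemma twistRank_le (l : List B) : twistRank cs θ (twistProd cs θ l) ≤ l.length :=
  Nat.sInf_le ⟨l, rfl, rfl⟩

lemma exists_length_eq_twistRank {w : W} (h : ∃ l : List B, twistProd cs θ l = w) :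
    ∃ l : List B, l.length = twistRank cs θ w ∧ twistProd cs θ l = w := by
  obtain ⟨l, hl⟩ := h
  exact Nat.sInf_mem (s := {k | ∃ l : List B, l.length = k ∧ twistProd cs θ l = w})
    ⟨l.length, l, rfl, hl⟩

lemma isAscending_of_length_eq_twistRank (hθ : Function.Involutive θ)
    (hθS : ∀ i : B, ∃ j : B, θ (cs.simple i) = cs.simple j) {l : List B}
    (hl : l.length = twistRank cs θ (twistProd cs θ l)) : IsAscending cs θ l := by
  induction l using List.reverseRecOn with
  | nil =>
    intro a i h
    simp at h
  | append_singleton l i ih =>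
    rw [List.length_append, List.length_singleton] at hl
    have hasc : IsAscending cs θ l := by
      apply ih
      obtain ⟨l', hlen, he⟩ := exists_length_eq_twistRank (cs := cs) (θ := θ) ⟨l, rfl⟩
      have h1 := twistRank_le (cs := cs) (θ := θ) (l' ++ [i])
      rw [twistProd_concat, he, ← twistProd_concat, ← hl] at h1
      have h2 := twistRank_le (cs := cs) (θ := θ) l
      simp only [List.length_append, List.length_singleton] at h1
      omega
    refine isAscending_concat_iff.2 ⟨hasc, ?_⟩
    by_contra hn
    have hd := lt_of_le_of_ne (not_lt.1 hn) (cs.length_mul_simple_ne (twistProd cs θ l) i)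
    have hm := twistProd_mem (cs := cs) hθ l
    have hle := (bruhatRel_twistAct_of_lt hθ hθS hm hd).tail (bruhatStep_of_mul_simple_lt hd)
    obtain ⟨l', hs, he⟩ := hasc.exists_sublist hθ hθS (twistAct_mem hθ hm i) hle
    have h1 := twistRank_le (cs := cs) (θ := θ) l'
    rw [he, ← twistProd_concat, ← hl] at h1
    have h2 := hs.length_le
    omega

end Twisted

theorem statement4 [Finite B] (cs : CoxeterSystem M W) (θ : W ≃* W)
    (hθ : Function.Involutive θ)
    (hθS : ∀ i : B, ∃ j : B, θ (cs.simple i) = cs.simple j)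
    (u v : W) (hu : u ∈ twistedInvolutions θ) (hv : v ∈ twistedInvolutions θ) :
    bruhatLE cs u v ↔
      ∀ l : List B, twistProd cs θ l = v → l.length = twistRank cs θ v →
        ∃ l' : List B, l'.Sublist l ∧ twistProd cs θ l' = u := by
  rw [bruhatLE_iff_bruhatRel]
  constructor
  · rintro h l rfl hl
    exact (isAscending_of_length_eq_twistRank hθ hθS hl).exists_sublist hθ hθS hu h
  · intro h
    obtain ⟨l, hl, rfl⟩ := exists_length_eq_twistRank (exists_twistProd_eq hθ hθS hv)
    obtain ⟨l', hs, rfl⟩ := h l rfl hl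
    exact (isAscending_of_length_eq_twistRank hθ hθS hl).bruhatRel_of_sublist hθ hθS hs

end TwistedIdentitiesPaper
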